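/- Let A be the subalgebra of Γ = F[x,y]/(x² + y⁴ − 1) generated by 1, y², xy, with derivation D (D(x) = 2y³, D(y) = −x), and set D₁₁ = (1 − y⁴)D, D₁₂ = xyD, D₂₂ = y²D. Then A is differentially simple with respect to the set Δ = {D₁₁, D₁₂, D₂₂}: every nonzero ideal of A invariant under all three derivations equals A. -/

import Mathlib

set_option synthInstance.maxHeartbeats 400000

open MvPolynomial

/-- The derivation `D = 2y³ ∂/∂x − x ∂/∂y` of `F[x,y]`. -/
noncomputable def Dxy (F : Type*) [Field F] :
    Derivation F (MvPolynomial (Fin 2) F) (MvPolynomial (Fin 2) F) :=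
  mkDerivation F ![2 * X 1 ^ 3, - X 0]

/-- The quotient ring `Γ = F[x,y]/(x² + y⁴ − 1)`. -/
abbrev Gam (F : Type*) [Field F] : Type _ :=
  MvPolynomial (Fin 2) F ⧸
    Ideal.span {(X 0 ^ 2 + X 1 ^ 4 - 1 : MvPolynomial (Fin 2) F)}

/-- The image of `x` in `Γ`. -/
noncomputable abbrev xG (F : Type*) [Field F] : Gam F := Ideal.Quotient.mk _ (X 0)

/-- The image of `y` in `Γ`. -/
noncomputable abbrev yG (F : Type*) [Field F] : Gam F := Ideal.Quotient.mk _ (X 1)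

/-- The subalgebra `A` of `Γ` generated by `1`, `y²`, `xy`. -/
noncomputable abbrev AG (F : Type*) [Field F] : Subalgebra F (Gam F) :=
  Algebra.adjoin F ({yG F ^ 2, xG F * yG F} : Set (Gam F))

open Polynomial in
/-- In characteristic zero, if `f` divides both `w * f'` and `w' * f' + 2 * w * f''`, where `f ≠ 0`
and `w` is separable, then `f` is a unit. -/
theorem isUnit_of_dvd_mul_derivative {F : Type*} [Field F] [CharZero F] {f w : F[X]} (hf : f ≠ 0)
    (hw : w.Separable) (h₁ : f ∣ w * derivative f)
    (h₂ : f ∣ derivative w * derivative f + 2 * w * derivative (derivative f)) : IsUnit f := by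
  by_contra hu
  obtain ⟨g, hg, hgf⟩ := WfDvdMonoid.exists_irreducible_factor hu hf
  have hp : Prime g := hg.prime
  have hfin : FiniteMultiplicity g f := FiniteMultiplicity.of_not_isUnit hg.not_isUnit hf
  obtain ⟨c, hfc, hc⟩ := hfin.exists_eq_pow_mul_and_not_dvd
  obtain ⟨j, hj⟩ : ∃ j, multiplicity g f = j + 1 :=
    Nat.exists_eq_add_one.mpr (multiplicity_pos_of_dvd hgf)
  rw [hj] at hfc
  clear hj hfin hgf
  have hnat : ∀ n : ℕ, ¬ g ∣ ((n + 1 : ℕ) : F[X]) := fun n h =>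
    hg.not_isUnit (isUnit_of_dvd_unit h (by
      rw [← Polynomial.C_eq_natCast, Polynomial.isUnit_C]
      exact (Nat.cast_ne_zero.mpr n.succ_ne_zero).isUnit))
  have hg' : ¬ g ∣ derivative g := fun h =>
    hg.not_isUnit (hg.separable.isUnit_of_dvd' dvd_rfl h)
  set e : F[X] := (j + 1 : ℕ) * (derivative g * c) + g * derivative c with he
  have hge : ¬ g ∣ e := by
    rw [he, dvd_add_left (dvd_mul_right _ _), hp.dvd_mul, hp.dvd_mul]
    exact not_or.mpr ⟨hnat j, not_or.mpr ⟨hg', hc⟩⟩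
  have hf' : derivative f = g ^ j * e := by
    rw [hfc, he, derivative_mul, derivative_pow_succ]
    simp only [map_add, map_natCast, map_one, Nat.cast_add, Nat.cast_one]
    ring
  have hpow : g * derivative (g ^ j) = g ^ j * (j * derivative g) := by
    cases j with
    | zero => simp
    | succ i =>
      rw [derivative_pow_succ]
      simp only [map_add, map_natCast, map_one, Nat.cast_add, Nat.cast_one]
      ring
  have hgj : g ^ j ≠ 0 := pow_ne_zero _ hg.ne_zero
  have cancel : ∀ z, f ∣ g ^ j * z → g ∣ z := fun z hz =>
    (mul_dvd_mul_iff_left hgj).mp ((Dvd.intro c (by rw [hfc, pow_succ])).trans hz)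
  have hgw : g ∣ w := by
    refine (hp.dvd_mul.mp (cancel (w * e) ?_)).resolve_right hge
    rw [hf'] at h₁
    convert h₁ using 1
    ring
  obtain ⟨h, rfl⟩ := hgw
  have key : g ∣ (2 * j + 1 : ℕ) * (h * (derivative g * e)) := by
    have : g ∣ (2 * j + 1 : ℕ) * (h * (derivative g * e)) +
        g * (derivative h * e + 2 * h * derivative e) := by
      refine cancel _ ?_
      rw [hf'] at h₂
      convert h₂ using 1
      simp only [derivative_mul, Nat.cast_add, Nat.cast_mul, Nat.cast_one, Nat.cast_ofNat]
      linear_combination -2 * h * e * hpow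
    exact (dvd_add_left (dvd_mul_right _ _)).mp this
  have hgh : g ∣ h := by
    rw [hp.dvd_mul, hp.dvd_mul, hp.dvd_mul] at key
    have := hnat (2 * j)
    tauto
  refine hg.not_isUnit (hw.isUnit_of_dvd' (dvd_mul_right _ _) ?_)
  rw [derivative_mul]
  exact dvd_add (hgh.mul_left _) (dvd_mul_right _ _)

open Polynomial in
theorem separable_X_sub_X_pow_three (F : Type*) [Field F] [CharZero F] :
    (Polynomial.X - Polynomial.X ^ 3 : F[X]).Separable := by
  refine ⟨Polynomial.C (9 / 2) * Polynomial.X, 1 - Polynomial.C (3 / 2) * Polynomial.X ^ 2, ?_⟩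
  have h3 : (Polynomial.C 3 : F[X]) = 3 := rfl
  have h9 : (Polynomial.C (9 / 2) : F[X]) = 3 * Polynomial.C (3 / 2) := by
    rw [← h3, ← Polynomial.C_mul]; congr 1; ring
  have h2 : (2 * Polynomial.C (3 / 2) : F[X]) = 3 := by
    rw [← h3, show (2 : F[X]) = Polynomial.C 2 from rfl, ← Polynomial.C_mul]; congr 1; ring
  simp only [derivative_sub, derivative_X, derivative_X_pow, h9]
  norm_num [h3]
  linear_combination Polynomial.X ^ 2 * h2

open Polynomial in
/-- A nonzero ideal stable under the derivation `u ↦ -2v`, `v ↦ 3u² - 1` of a quotient of the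
coordinate ring of the curve `v² = u - u³` is the whole ring. -/
theorem ideal_eq_top_of_derivation_stable {F B : Type*} [Field F] [CharZero F] [CommRing B]
    [Algebra F B] (δ : Derivation F B B) {u v : B} (hu : δ u = -2 * v) (hv : δ v = 3 * u ^ 2 - 1)
    (huv : v ^ 2 = u - u ^ 3) (hgen : ∀ b : B, ∃ p q : F[X], b = aeval u p + v * aeval u q)
    {I : Ideal B} (hI : I ≠ ⊥) (hδ : ∀ b ∈ I, δ b ∈ I) : I = ⊤ := by
  have half : ∀ b : B, -2 * b ∈ I → b ∈ I := fun b hb => by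
    have := I.mul_mem_left (algebraMap F B (-1 / 2)) hb
    rwa [show (-2 : B) = algebraMap F B (-2) by rw [map_neg, map_ofNat], ← mul_assoc, ← map_mul,
      show (-1 / 2 * -2 : F) = 1 by norm_num, map_one, one_mul] at this
  have hδp : ∀ p : F[X], δ (aeval u p) = -2 * (v * aeval u (derivative p)) := fun p => by
    rw [Derivation.map_aeval, hu, smul_eq_mul]; ring
  have hvp : ∀ p : F[X], aeval u p ∈ I → v * aeval u (derivative p) ∈ I := fun p hp =>
    half _ (hδp p ▸ hδ _ hp)
  set J : Ideal F[X] := I.comap (aeval u : F[X] →ₐ[F] B)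
  have memJ : ∀ p, p ∈ J ↔ aeval u p ∈ I := fun p => Iff.rfl
  have hJ0 : J ≠ ⊥ := by
    obtain ⟨b, hb, hb0⟩ := Submodule.exists_mem_ne_zero_of_ne_bot hI
    obtain ⟨p, q, rfl⟩ := hgen b
    have hmem : p ^ 2 - (Polynomial.X - Polynomial.X ^ 3) * q ^ 2 ∈ J := by
      rw [memJ]
      convert I.mul_mem_left (aeval u p - v * aeval u q) hb using 1
      simp only [map_sub, map_mul, map_pow, Polynomial.aeval_X]
      linear_combination aeval u q ^ 2 * huv
    refine fun hbot => hb0 ?_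
    rw [hbot, Ideal.mem_bot, sub_eq_zero] at hmem
    have hdeg : (Polynomial.X - Polynomial.X ^ 3 : F[X]).natDegree = 3 := by compute_degree!
    have hX : (Polynomial.X - Polynomial.X ^ 3 : F[X]) ≠ 0 := fun h => by simp [h] at hdeg
    have hq : q = 0 := by
      by_contra hq
      have h := congrArg natDegree hmem
      rw [natDegree_mul hX (pow_ne_zero 2 hq), hdeg, natDegree_pow, natDegree_pow] at h
      omega
    have hp : p = 0 := by simpa [hq] using hmem
    simp [hp, hq]
  obtain ⟨f, hf⟩ := (IsPrincipalIdealRing.principal J).principal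
  have hdvd : ∀ p : F[X], aeval u p ∈ I → f ∣ p := fun p hp => by
    rwa [← memJ, hf, Ideal.submodule_span_eq, Ideal.mem_span_singleton] at hp
  have hfI : aeval u f ∈ I := by
    rw [← memJ, hf]; exact Submodule.mem_span_singleton_self f
  have hf0 : f ≠ 0 := fun h => hJ0 (by rw [hf, h]; simp)
  have hunit : IsUnit f := by
    refine isUnit_of_dvd_mul_derivative hf0 (separable_X_sub_X_pow_three F) (hdvd _ ?_) (hdvd _ ?_)
    · convert I.mul_mem_left v (hvp f hfI) using 1
      simp only [map_sub, map_mul, map_pow, Polynomial.aeval_X]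
      linear_combination -aeval u (derivative f) * huv
    · convert I.neg_mem (hδ _ (hvp f hfI)) using 1
      simp only [Derivation.leibniz, hδp, hv, smul_eq_mul, map_sub, map_mul, map_pow, map_add,
        Polynomial.aeval_X, derivative_X, derivative_X_pow, map_one, map_natCast, map_ofNat]
      norm_num
      linear_combination -2 * aeval u (derivative (derivative f)) * huv
  exact I.eq_top_of_isUnit_mem hfI (hunit.map (Polynomial.aeval u))

open Polynomial in
/-- If `v ^ 2` is a polynomial in `u`, then `F[u, v] = F[u] + v F[u]`. -/
theorem exists_eq_aeval_add_mul_aeval {F B : Type*} [Field F] [CommRing B] [Algebra F B]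
    {u v : B} {w : F[X]} (huv : v ^ 2 = aeval u w) {b : B} (hb : b ∈ Algebra.adjoin F {u, v}) :
    ∃ p q : F[X], b = aeval u p + v * aeval u q := by
  induction hb using Algebra.adjoin_induction with
  | mem x hx =>
    rcases hx with rfl | rfl
    · exact ⟨Polynomial.X, 0, by simp⟩
    · exact ⟨0, 1, by simp⟩
  | algebraMap r => exact ⟨Polynomial.C r, 0, by simp⟩
  | add x y _ _ hx hy =>
    obtain ⟨p, q, rfl⟩ := hx
    obtain ⟨p', q', rfl⟩ := hy
    exact ⟨p + p', q + q', by simp only [map_add]; ring⟩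
  | mul x y _ _ hx hy =>
    obtain ⟨p, q, rfl⟩ := hx
    obtain ⟨p', q', rfl⟩ := hy
    refine ⟨p * p' + w * (q * q'), p * q' + q * p', ?_⟩
    simp only [map_add, map_mul]
    linear_combination aeval u q * aeval u q' * huv

/-- The restriction of a derivation to a subalgebra that it preserves. -/
noncomputable def Derivation.restrictSubalgebra {F B : Type*} [CommRing F] [CommRing B]
    [Algebra F B] (D : Derivation F B B) (S : Subalgebra F B) (h : ∀ a : S, D a ∈ S) :
    Derivation F S S :=
  Derivation.mk' ((D.toLinearMap.comp S.val.toLinearMap).codRestrict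
    (Subalgebra.toSubmodule S) h) fun a b => by
      apply Subtype.ext
      change D ((a : B) * b) = a * D b + b * D a
      simp [Derivation.leibniz]

/-- `A` is differentially simple with respect to the set
`Δ = {D₁₁, D₁₂, D₂₂}` where `D₁₁ = (1 − y⁴)D`, `D₁₂ = xyD`, `D₂₂ = y²D`:
every nonzero ideal of `A` invariant under all three derivations equals `A`. -/
theorem stmt15 (F : Type*) [Field F] [CharZero F]
    (D' : Derivation F (Gam F) (Gam F))
    (hD' : ∀ p : MvPolynomial (Fin 2) F,
      D' (Ideal.Quotient.mk _ p) = Ideal.Quotient.mk _ (Dxy F p))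
    (h11 : ∀ a : AG F, (1 - yG F ^ 4) * D' (a : Gam F) ∈ AG F)
    (h12 : ∀ a : AG F, xG F * yG F * D' (a : Gam F) ∈ AG F)
    (h22 : ∀ a : AG F, yG F ^ 2 * D' (a : Gam F) ∈ AG F)
    (I : Ideal (AG F)) (hI : I ≠ ⊥)
    (hinv11 : ∀ a : AG F, a ∈ I →
      (⟨(1 - yG F ^ 4) * D' (a : Gam F), h11 a⟩ : AG F) ∈ I)
    (hinv12 : ∀ a : AG F, a ∈ I →
      (⟨xG F * yG F * D' (a : Gam F), h12 a⟩ : AG F) ∈ I)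
    (hinv22 : ∀ a : AG F, a ∈ I →
      (⟨yG F ^ 2 * D' (a : Gam F), h22 a⟩ : AG F) ∈ I) :
    I = ⊤ := by
  have hxy : xG F ^ 2 + yG F ^ 4 - 1 = 0 := by
    have : (Ideal.Quotient.mk (Ideal.span {(X 0 ^ 2 + X 1 ^ 4 - 1 : MvPolynomial (Fin 2) F)}))
        (X 0 ^ 2 + X 1 ^ 4 - 1) = 0 :=
      Ideal.Quotient.eq_zero_iff_mem.mpr (Ideal.mem_span_singleton_self _)
    simpa only [map_sub, map_add, map_pow, map_one] using this
  have hDx : D' (xG F) = 2 * yG F ^ 3 := by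
    rw [hD', Dxy, mkDerivation_X]
    rfl
  have hDy : D' (yG F) = -xG F := by
    rw [hD', Dxy, mkDerivation_X]
    simp
  have hyA : yG F ^ 2 ∈ AG F := Algebra.subset_adjoin (Or.inl rfl)
  have hxyA : xG F * yG F ∈ AG F := Algebra.subset_adjoin (Or.inr rfl)
  have hsum : ∀ a : AG F,
      (1 - yG F ^ 4) * D' (a : Gam F) + yG F ^ 2 * (yG F ^ 2 * D' (a : Gam F)) = D' a :=
    fun a => by ring
  have hDA : ∀ a : AG F, D' (a : Gam F) ∈ AG F := fun a =>
    hsum a ▸ add_mem (h11 a) (mul_mem hyA (h22 a))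
  have huv : (xG F * yG F) ^ 2 = yG F ^ 2 - (yG F ^ 2) ^ 3 := by
    linear_combination yG F ^ 2 * hxy
  refine ideal_eq_top_of_derivation_stable (D'.restrictSubalgebra (AG F) hDA)
    (u := ⟨yG F ^ 2, hyA⟩) (v := ⟨xG F * yG F, hxyA⟩) ?_ ?_ (Subtype.ext huv) ?_ hI ?_
  · apply Subtype.ext
    change D' (yG F ^ 2) = -2 * (xG F * yG F)
    rw [Derivation.leibniz_pow, hDy]
    simp only [smul_eq_mul, nsmul_eq_mul]
    push_cast
    ring
  · apply Subtype.ext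
    change D' (xG F * yG F) = 3 * (yG F ^ 2) ^ 2 - 1
    rw [Derivation.leibniz, hDx, hDy]
    simp only [smul_eq_mul]
    linear_combination -hxy
  · intro b
    obtain ⟨p, q, h⟩ := exists_eq_aeval_add_mul_aeval (w := Polynomial.X - Polynomial.X ^ 3)
      (by simpa using huv) b.2
    refine ⟨p, q, Subtype.ext ?_⟩
    simpa [Polynomial.aeval_subalgebra_coe] using h
  · intro b hb
    convert I.add_mem (hinv11 b hb) (I.mul_mem_left ⟨yG F ^ 2, hyA⟩ (hinv22 b hb)) using 1
    exact Subtype.ext (hsum b).symm
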